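/- Let n > 0, β > 0, u ∈ ℝ³ and let J(q) = J(n,β,u;q) be the Jüttner distribution. Then: (1) ∫_{ℝ³} J dq = n√(1+|u|²) and ∫_{ℝ³} qⁱ J dq/q⁰ = n uⁱ for i = 1,2,3; (2) ∫_{ℝ³} |q|² J dq/q⁰ = n Ψ(β)|u|² + (3 + |u|²) n/β; (3) ∫_{ℝ³} √(1+|q|²) J dq = (n/β)|u|² + n Ψ(β)(1 + |u|²); (4) ∫_{ℝ³} qⁱ J dq = (n Ψ(β) + n/β) √(1+|u|²) uⁱ for i = 1,2,3; (5) ∫_{ℝ³} J dq/q⁰ = n (Ψ(β) − 3/β) = n K₁(β)/K₂(β). -/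

import Mathlib

open MeasureTheory Real
open scoped InnerProductSpace

noncomputable section

/-- Momentum space `ℝ³`. -/
abbrev E3 := EuclideanSpace ℝ (Fin 3)

/-- `q⁰ = √(1+|q|²)`. -/
def q0 (q : E3) : ℝ := Real.sqrt (1 + ‖q‖ ^ 2)

/-- Modified Bessel function `K_j(β) = ∫₀^∞ cosh(j r) exp(−β cosh r) dr`. -/
def Kb (j : ℕ) (β : ℝ) : ℝ :=
  ∫ r in Set.Ioi (0 : ℝ), Real.cosh (j * r) * Real.exp (-β * Real.cosh r)

end

noncomputable section

/-- `M(β) = ∫_{ℝ³} exp(−β √(1+|p|²)) dp`. -/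
def Mf (β : ℝ) : ℝ := ∫ p : E3, Real.exp (-β * Real.sqrt (1 + ‖p‖ ^ 2))

/-- `Ψ(β) = 3/β + K₁(β)/K₂(β)`. -/
def Ψf (β : ℝ) : ℝ := 3 / β + Kb 1 β / Kb 2 β

/-- The dimensionless Jüttner distribution
`J(n,β,u;q) = (n/M(β)) exp(−β(√(1+|u|²) q⁰ − u·q))`. -/
def Jut (n β : ℝ) (u : E3) (q : E3) : ℝ :=
  n / Mf β * Real.exp (-β * (Real.sqrt (1 + ‖u‖ ^ 2) * q0 q - ⟪u, q⟫_ℝ))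

end

section Boost

lemma q0_sq (q : E3) : q0 q ^ 2 = 1 + ‖q‖ ^ 2 := Real.sq_sqrt (by positivity)

lemma q0_pos (q : E3) : 0 < q0 q := Real.sqrt_pos.2 (by positivity)

lemma one_le_q0 (q : E3) : 1 ≤ q0 q := Real.one_le_sqrt.2 (by nlinarith [sq_nonneg ‖q‖])

lemma norm_le_q0 (q : E3) : ‖q‖ ≤ q0 q := Real.le_sqrt_of_sq_le (by linarith)

lemma q0_neg (q : E3) : q0 (-q) = q0 q := by simp [q0]

lemma continuous_q0 : Continuous q0 := by unfold q0; fun_prop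

lemma hasFDerivAt_q0 (q : E3) : HasFDerivAt q0 ((q0 q)⁻¹ • innerSL ℝ q) q := by
  have h : HasFDerivAt (fun x : E3 => 1 + ‖x‖ ^ 2) (2 • innerSL ℝ q) q :=
    ((hasStrictFDerivAt_norm_sq q).hasFDerivAt).const_add 1
  refine (h.sqrt (by positivity)).congr_fderiv ?_
  ext v
  simp [q0]
  ring

/-- The Lorentz boost of the unit mass shell, parametrised by `ℝ³`, taking `0` to `u`. -/
noncomputable def boost (u q : E3) : E3 := q + (⟪u, q⟫_ℝ / (1 + q0 u) + q0 q) • u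

lemma inner_boost (u q : E3) :
    ⟪u, boost u q⟫_ℝ = q0 u * ⟪u, q⟫_ℝ + q0 q * ‖u‖ ^ 2 := by
  have h : (1 + q0 u) ≠ 0 := by linarith [q0_pos u]
  have hu : ‖u‖ ^ 2 = q0 u ^ 2 - 1 := by rw [q0_sq]; ring
  rw [boost, inner_add_right, real_inner_smul_right, real_inner_self_eq_norm_sq, hu]
  field_simp
  ring

lemma energy_pos (u q : E3) : 0 < q0 u * q0 q + ⟪u, q⟫_ℝ := by
  have h1 := (abs_le.1 (abs_real_inner_le_norm u q)).1
  have hu := q0_sq u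
  have h2 : ‖u‖ < q0 u := by
    refine lt_of_pow_lt_pow_left₀ 2 (q0_pos u).le ?_
    linarith
  have h3 : ‖u‖ * ‖q‖ < q0 u * q0 q :=
    (mul_le_mul_of_nonneg_left (norm_le_q0 q) (norm_nonneg u)).trans_lt
      (mul_lt_mul_of_pos_right h2 (q0_pos q))
  linarith

lemma q0_boost (u q : E3) : q0 (boost u q) = q0 u * q0 q + ⟪u, q⟫_ℝ := by
  have h : (1 + q0 u) ≠ 0 := by linarith [q0_pos u]
  have hu : ‖u‖ ^ 2 = q0 u ^ 2 - 1 := by rw [q0_sq]; ring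
  have hq : ‖q‖ ^ 2 = q0 q ^ 2 - 1 := by rw [q0_sq]; ring
  rw [← pow_left_inj₀ (q0_pos _).le (energy_pos u q).le two_ne_zero, q0_sq, boost,
    norm_add_sq_real, real_inner_smul_right, norm_smul, mul_pow, hu, hq, real_inner_comm,
    Real.norm_eq_abs, sq_abs]
  field_simp
  ring

lemma boost_neg_boost (u q : E3) : boost (-u) (boost u q) = q := by
  have h : (1 + q0 u) ≠ 0 := by linarith [q0_pos u]
  have hu : ‖u‖ ^ 2 = q0 u ^ 2 - 1 := by rw [q0_sq]; ring
  rw [boost, inner_neg_left, inner_boost, q0_boost, q0_neg, boost, smul_neg, add_assoc,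
    ← sub_eq_add_neg, ← sub_smul, add_eq_left, hu]
  convert zero_smul ℝ u
  field_simp
  ring

lemma boost_boost_neg (u q : E3) : boost u (boost (-u) q) = q := by
  simpa using boost_neg_boost (-u) q

lemma bijective_boost (u : E3) : Function.Bijective (boost u) :=
  Function.bijective_iff_has_inverse.2 ⟨boost (-u), boost_neg_boost u, boost_boost_neg u⟩

lemma hasFDerivAt_boost (u q : E3) :
    HasFDerivAt (boost u)
      (ContinuousLinearMap.id ℝ E3 +
        (((1 + q0 u)⁻¹ • innerSL ℝ u + (q0 q)⁻¹ • innerSL ℝ q).smulRight u)) q := by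
  have h1 : HasFDerivAt (fun x : E3 => ⟪u, x⟫_ℝ / (1 + q0 u)) ((1 + q0 u)⁻¹ • innerSL ℝ u) q := by
    simpa [div_eq_inv_mul] using ((innerSL ℝ u).hasFDerivAt (x := q)).const_mul (1 + q0 u)⁻¹
  exact (hasFDerivAt_id q).add ((h1.add (hasFDerivAt_q0 q)).smul_const u)

lemma det_fderiv_boost (u q : E3) :
    (ContinuousLinearMap.id ℝ E3 +
        (((1 + q0 u)⁻¹ • innerSL ℝ u + (q0 q)⁻¹ • innerSL ℝ q).smulRight u)).det
      = q0 (boost u q) / q0 q := by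
  have h : (1 + q0 u) ≠ 0 := by linarith [q0_pos u]
  have hq := (q0_pos q).ne'
  have hu : ‖u‖ ^ 2 = q0 u ^ 2 - 1 := by rw [q0_sq]; ring
  have := LinearMap.transvection.det
    (((1 + q0 u)⁻¹ • innerSL ℝ u + (q0 q)⁻¹ • innerSL ℝ q : E3 →L[ℝ] ℝ) : E3 →ₗ[ℝ] ℝ) u
  rw [q0_boost]
  refine Eq.trans ?_ (this.trans ?_)
  · rfl
  · simp only [ContinuousLinearMap.coe_coe, add_apply,
      smul_apply, innerSL_apply_apply, real_inner_self_eq_norm_sq, hu, smul_eq_mul,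
      real_inner_comm u q]
    field_simp
    ring

/-- Lorentz invariance of the measure `dq / q⁰`. -/
lemma integral_div_q0_eq_integral_boost (u : E3) (f : E3 → ℝ) :
    ∫ q, f q / q0 q = ∫ q, f (boost u q) / q0 q := by
  have h := integral_image_eq_integral_abs_det_fderiv_smul volume MeasurableSet.univ
    (fun q _ => (hasFDerivAt_boost u q).hasFDerivWithinAt) (bijective_boost u).1.injOn
    (fun q => f q / q0 q)
  rw [Set.image_univ, (bijective_boost u).2.range_eq] at h
  simp only [Measure.restrict_univ] at h
  rw [h]
  congr 1 with q
  have h1 := q0_pos q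
  have h2 := q0_pos (boost u q)
  rw [det_fderiv_boost, abs_of_pos (by positivity), smul_eq_mul]
  field_simp

/-- Moments of the Jüttner distribution computed in the local rest frame. -/
lemma integral_mul_jut (n β : ℝ) (u : E3) (g : E3 → ℝ) :
    ∫ q, g q * Jut n β u q / q0 q =
      n / Mf β * ∫ q, g (boost u q) * (Real.exp (-β * q0 q) / q0 q) := by
  rw [integral_div_q0_eq_integral_boost u, ← integral_const_mul]
  congr 1 with q
  have : Real.sqrt (1 + ‖u‖ ^ 2) * q0 (boost u q) - ⟪u, boost u q⟫_ℝ = q0 q := by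
    rw [inner_boost, q0_boost, show Real.sqrt (1 + ‖u‖ ^ 2) = q0 u from rfl,
      show ‖u‖ ^ 2 = q0 u ^ 2 - 1 by rw [q0_sq]; ring]
    ring
  rw [Jut, this]
  ring

end Boost

section Hyperbolic

lemma pow_mul_exp_neg_le {β x : ℝ} (hβ : 0 < β) (hx : 0 ≤ x) (k : ℕ) :
    x ^ k * Real.exp (-β * x) ≤ k.factorial / β ^ k := by
  have h := Real.pow_div_factorial_le_exp (β * x) (by positivity) k
  have hf : (0 : ℝ) < k.factorial := by positivity
  rw [neg_mul, Real.exp_neg, ← div_eq_mul_inv, div_le_div_iff₀ (Real.exp_pos _) (by positivity)]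
  rw [div_le_iff₀ hf, mul_pow] at h
  linarith

lemma abs_mul_exp_neg_cosh_le {β C : ℝ} (hβ : 0 < β) {k : ℕ} {g : ℝ → ℝ}
    (hg : ∀ r, |g r| ≤ C * Real.cosh r ^ k) (r : ℝ) :
    |g r * Real.exp (-β * Real.cosh r)| ≤
      C * ((k + 1).factorial / β ^ (k + 1)) * 2 * Real.exp (-1 * r) := by
  have hc := Real.cosh_pos r
  have hC : 0 ≤ C := by
    have := (abs_nonneg _).trans (hg 0)
    simpa using this
  have h := pow_mul_exp_neg_le hβ hc.le (k + 1)
  set D : ℝ := (k + 1).factorial / β ^ (k + 1)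
  have hD : 0 ≤ D := le_trans (by positivity) h
  have h2 : 1 ≤ 2 * Real.exp (-1 * r) * Real.cosh r := by
    have h3 : Real.exp (-r) * Real.exp r = 1 := by rw [← Real.exp_add]; simp
    rw [Real.cosh_eq, neg_one_mul]
    nlinarith [sq_nonneg (Real.exp (-r))]
  rw [abs_mul, Real.abs_exp]
  have hE := Real.exp_pos (-β * Real.cosh r)
  calc |g r| * Real.exp (-β * Real.cosh r)
      ≤ C * Real.cosh r ^ k * Real.exp (-β * Real.cosh r) := by gcongr; exact hg r
    _ ≤ C * Real.cosh r ^ k * Real.exp (-β * Real.cosh r)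
          * (2 * Real.exp (-1 * r) * Real.cosh r) := le_mul_of_one_le_right (by positivity) h2
    _ = C * (Real.cosh r ^ (k + 1) * Real.exp (-β * Real.cosh r)) * 2 * Real.exp (-1 * r) := by
        ring
    _ ≤ C * D * 2 * Real.exp (-1 * r) := by gcongr

lemma integrableOn_mul_exp_neg_cosh {β C : ℝ} (hβ : 0 < β) {k : ℕ} {g : ℝ → ℝ}
    (hc : Continuous g) (hg : ∀ r, |g r| ≤ C * Real.cosh r ^ k) :
    IntegrableOn (fun r => g r * Real.exp (-β * Real.cosh r)) (Set.Ioi 0) := by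
  refine Integrable.mono' ((exp_neg_integrableOn_Ioi 0 one_pos).const_mul
    (C * ((k + 1).factorial / β ^ (k + 1)) * 2)) ?_ (ae_of_all _ fun r => ?_)
  · exact (by fun_prop : Continuous fun r => g r * Real.exp (-β * Real.cosh r)).aestronglyMeasurable
  · exact abs_mul_exp_neg_cosh_le hβ hg r

lemma tendsto_mul_exp_neg_cosh {β C : ℝ} (hβ : 0 < β) {k : ℕ} {g : ℝ → ℝ}
    (hg : ∀ r, |g r| ≤ C * Real.cosh r ^ k) :
    Filter.Tendsto (fun r => g r * Real.exp (-β * Real.cosh r)) Filter.atTop (nhds 0) := by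
  refine squeeze_zero_norm (abs_mul_exp_neg_cosh_le hβ hg) ?_
  have : Filter.Tendsto (fun r : ℝ => Real.exp (-1 * r)) Filter.atTop (nhds 0) := by
    simpa using Real.tendsto_exp_neg_atTop_nhds_zero
  simpa using this.const_mul (C * ((k + 1).factorial / β ^ (k + 1)) * 2)

lemma abs_sinh_le_cosh (r : ℝ) : |Real.sinh r| ≤ Real.cosh r :=
  abs_le.2 ⟨by linarith [Real.exp_pos r, Real.cosh_add_sinh r], (Real.sinh_lt_cosh r).le⟩

/-- Integration by parts against `sinh r * exp (-β cosh r)`. -/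
lemma integral_mul_sinh_mul_exp_neg_cosh {β C : ℝ} (hβ : 0 < β) {k : ℕ} {f f' : ℝ → ℝ}
    (hf : ∀ r, HasDerivAt f (f' r) r) (hc : Continuous f') (h0 : f 0 = 0)
    (hb : ∀ r, |f r| ≤ C * Real.cosh r ^ k) (hb' : ∀ r, |f' r| ≤ C * Real.cosh r ^ k) :
    ∫ r in Set.Ioi (0 : ℝ), f r * Real.sinh r * Real.exp (-β * Real.cosh r) =
      (∫ r in Set.Ioi (0 : ℝ), f' r * Real.exp (-β * Real.cosh r)) / β := by
  have hfc : Continuous f := continuous_iff_continuousAt.2 fun r => (hf r).continuousAt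
  have hbs : ∀ r, |f r * Real.sinh r| ≤ C * Real.cosh r ^ (k + 1) := fun r => by
    rw [abs_mul, pow_succ, ← mul_assoc]
    exact mul_le_mul (hb r) (abs_sinh_le_cosh r) (abs_nonneg _) ((abs_nonneg _).trans (hb r))
  have i1 := integrableOn_mul_exp_neg_cosh hβ hc hb'
  have i2 : IntegrableOn (fun r => f r * Real.sinh r * Real.exp (-β * Real.cosh r)) (Set.Ioi 0) :=
    integrableOn_mul_exp_neg_cosh hβ (hfc.mul Real.continuous_sinh) hbs
  have hd : ∀ r ∈ Set.Ici (0 : ℝ), HasDerivAt (fun r => f r * Real.exp (-β * Real.cosh r))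
      (f' r * Real.exp (-β * Real.cosh r)
        - β * (f r * Real.sinh r * Real.exp (-β * Real.cosh r))) r := fun r _ => by
    refine ((hf r).mul (((Real.hasDerivAt_cosh r).const_mul (-β)).exp)).congr_deriv ?_
    ring
  have h := integral_Ioi_of_hasDerivAt_of_tendsto' hd (i1.sub (i2.const_mul β))
    (tendsto_mul_exp_neg_cosh hβ hb)
  rw [integral_sub i1 (i2.const_mul β), integral_const_mul, h0] at h
  rw [eq_div_iff hβ.ne']
  linarith

lemma integral_sinh_sq {β : ℝ} (hβ : 0 < β) :
    ∫ r in Set.Ioi (0 : ℝ), Real.sinh r ^ 2 * Real.exp (-β * Real.cosh r) = Kb 1 β / β := by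
  have h := integral_mul_sinh_mul_exp_neg_cosh hβ (C := 1) (k := 1)
    (fun r => Real.hasDerivAt_sinh r) Real.continuous_cosh Real.sinh_zero
    (fun r => by simpa using abs_sinh_le_cosh r) (fun r => by simp [abs_of_pos (Real.cosh_pos r)])
  simpa [Kb, pow_two] using h

lemma integral_sinh_sq_mul_cosh {β : ℝ} (hβ : 0 < β) :
    ∫ r in Set.Ioi (0 : ℝ), Real.sinh r ^ 2 * Real.cosh r * Real.exp (-β * Real.cosh r)
      = Kb 2 β / β := by
  have h := integral_mul_sinh_mul_exp_neg_cosh hβ (C := 2) (k := 2)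
    (fun r => (Real.hasDerivAt_sinh r).mul (Real.hasDerivAt_cosh r)) (by fun_prop) (by simp)
    (fun r => by
      have := abs_sinh_le_cosh r
      have hc := Real.cosh_pos r
      simp only [Pi.mul_apply, abs_mul, abs_of_pos hc]
      nlinarith)
    (fun r => by
      have := sq_le_sq' (abs_le.1 (abs_sinh_le_cosh r)).1 (abs_le.1 (abs_sinh_le_cosh r)).2
      rw [abs_of_nonneg (by nlinarith [sq_nonneg (Real.sinh r), sq_nonneg (Real.cosh r)])]
      nlinarith)
  refine (integral_congr_ae (ae_of_all _ fun r => ?_)).trans (h.trans ?_)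
  · simp only [Pi.mul_apply]; ring
  · rw [Kb]
    congr 1
    refine integral_congr_ae (ae_of_all _ fun r => ?_)
    simp only [Nat.cast_ofNat, Real.cosh_two_mul]
    ring

lemma integral_sinh_pow_four {β : ℝ} (hβ : 0 < β) :
    ∫ r in Set.Ioi (0 : ℝ), Real.sinh r ^ 4 * Real.exp (-β * Real.cosh r) =
      3 / β * ∫ r in Set.Ioi (0 : ℝ),
        Real.sinh r ^ 2 * Real.cosh r * Real.exp (-β * Real.cosh r) := by
  have h := integral_mul_sinh_mul_exp_neg_cosh hβ (C := 3) (k := 3)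
    (fun r => (Real.hasDerivAt_sinh r).pow 3) (by fun_prop) (by simp)
    (fun r => by
      have := pow_le_pow_left₀ (abs_nonneg _) (abs_sinh_le_cosh r) 3
      have hc := pow_pos (Real.cosh_pos r) 3
      simp only [Pi.pow_apply, abs_pow]
      linarith)
    (fun r => by
      have := pow_le_pow_left₀ (abs_nonneg _) (abs_sinh_le_cosh r) 2
      have hc := Real.cosh_pos r
      rw [abs_mul, abs_mul, abs_of_pos hc, abs_pow]
      norm_num at this ⊢
      nlinarith)
  refine (integral_congr_ae (ae_of_all _ fun r => ?_)).trans (h.trans ?_)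
  · simp only [Pi.pow_apply]; ring
  · rw [div_mul_eq_mul_div, ← integral_const_mul]
    congr 1
    refine integral_congr_ae (ae_of_all _ fun r => ?_)
    norm_num
    ring

end Hyperbolic

section Radial

lemma integral_comp_q0 (φ : ℝ → ℝ) :
    ∫ q : E3, φ (q0 q) = 3 * (volume : Measure E3).real (Metric.ball 0 1) *
      ∫ r in Set.Ioi (0 : ℝ), Real.sinh r ^ 2 * Real.cosh r * φ (Real.cosh r) := by
  have h := integral_fun_norm_addHaar (volume : Measure E3) fun y => φ (Real.sqrt (1 + y ^ 2))
  have himg : Real.sinh '' Set.Ioi 0 = Set.Ioi 0 := by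
    ext y
    simp only [Set.mem_image, Set.mem_Ioi]
    exact ⟨fun ⟨r, hr, e⟩ => e ▸ Real.sinh_pos_iff.2 hr,
      fun hy => ⟨Real.arsinh y, Real.arsinh_pos_iff.2 hy, Real.sinh_arsinh y⟩⟩
  have h2 := integral_image_eq_integral_abs_deriv_smul (measurableSet_Ioi (a := (0 : ℝ)))
    (fun r _ => (Real.hasDerivAt_sinh r).hasDerivWithinAt) Real.sinh_injective.injOn
    (fun y => y ^ 2 * φ (Real.sqrt (1 + y ^ 2)))
  rw [himg] at h2
  simp only [finrank_euclideanSpace, Fintype.card_fin, Nat.add_one_sub_one, smul_eq_mul,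
    nsmul_eq_mul, Nat.cast_ofNat] at h h2
  unfold q0
  rw [h, h2, mul_assoc]
  congr 3 with r
  rw [abs_of_pos (Real.cosh_pos r), add_comm, ← Real.cosh_sq, Real.sqrt_sq (Real.cosh_pos r).le]
  ring

lemma integrable_of_abs_le {β : ℝ} (hβ : 0 < β) {f : E3 → ℝ} (hf : Continuous f) {C : ℝ} (k : ℕ)
    (hb : ∀ q, |f q| ≤ C * q0 q ^ k * Real.exp (-β * q0 q)) : Integrable f := by
  have hC : 0 ≤ C := by
    have h := (abs_nonneg _).trans (hb 0)
    have h2 : 0 < q0 0 ^ k * Real.exp (-β * q0 0) := by have := q0_pos 0; positivity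
    rw [mul_assoc] at h
    exact nonneg_of_mul_nonneg_left h h2
  have hi : Integrable (fun q : E3 => (1 + ‖q‖) ^ (-4 : ℝ)) :=
    integrable_one_add_norm (by simp; norm_num)
  refine (hi.const_mul (C * ((k + 4).factorial / β ^ (k + 4)) * 16)).mono'
    hf.aestronglyMeasurable (ae_of_all _ fun q => (hb q).trans ?_)
  have hq := q0_pos q
  have h := pow_mul_exp_neg_le hβ hq.le (k + 4)
  set D : ℝ := (k + 4).factorial / β ^ (k + 4)
  have hD : 0 ≤ D := le_trans (by positivity) h
  have hn : 0 < 1 + ‖q‖ := by positivity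
  have h1 : (1 + ‖q‖) ^ 4 ≤ (2 * q0 q) ^ 4 :=
    pow_le_pow_left₀ hn.le (by linarith [one_le_q0 q, norm_le_q0 q]) 4
  rw [show (-4 : ℝ) = -((4 : ℕ) : ℝ) by norm_num, Real.rpow_neg hn.le, Real.rpow_natCast,
    ← div_eq_mul_inv, le_div_iff₀ (by positivity)]
  calc C * q0 q ^ k * Real.exp (-β * q0 q) * (1 + ‖q‖) ^ 4
      ≤ C * q0 q ^ k * Real.exp (-β * q0 q) * (2 * q0 q) ^ 4 := by gcongr
    _ = C * (q0 q ^ (k + 4) * Real.exp (-β * q0 q)) * 16 := by ring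
    _ ≤ C * D * 16 := by gcongr

lemma Mf_eq (β : ℝ) : Mf β = ∫ q : E3, Real.exp (-β * q0 q) := rfl

lemma Mf_pos {β : ℝ} (hβ : 0 < β) : 0 < Mf β := by
  rw [Mf_eq]
  refine integral_exp_pos (integrable_of_abs_le hβ (C := 1) ?_ 0 fun q => by simp)
  have := continuous_q0
  fun_prop

lemma integral_exp_div_q0 {β : ℝ} (hβ : 0 < β) :
    ∫ q : E3, Real.exp (-β * q0 q) / q0 q = Mf β * (Kb 1 β / Kb 2 β) := by
  have h1 := integral_comp_q0 fun x => Real.exp (-β * x) / x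
  have h2 := integral_comp_q0 fun x => Real.exp (-β * x)
  have h3 : ∀ r, Real.sinh r ^ 2 * Real.cosh r * (Real.exp (-β * Real.cosh r) / Real.cosh r) =
      Real.sinh r ^ 2 * Real.exp (-β * Real.cosh r) := fun r => by
    have := (Real.cosh_pos r).ne'
    field_simp
  simp only [h3, integral_sinh_sq hβ, integral_sinh_sq_mul_cosh hβ] at h1 h2
  have hM := Mf_pos hβ
  rw [Mf_eq, h2] at hM
  have hK : Kb 2 β ≠ 0 := fun h => by simp [h] at hM
  rw [h1, Mf_eq, h2]
  field_simp

lemma integral_norm_sq_mul_exp_div_q0 {β : ℝ} (hβ : 0 < β) :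
    ∫ q : E3, ‖q‖ ^ 2 * (Real.exp (-β * q0 q) / q0 q) = 3 * (Mf β / β) := by
  have h1 := integral_comp_q0 fun x => (x ^ 2 - 1) * (Real.exp (-β * x) / x)
  have h2 := integral_comp_q0 fun x => Real.exp (-β * x)
  have h3 : ∀ r, Real.sinh r ^ 2 * Real.cosh r *
      ((Real.cosh r ^ 2 - 1) * (Real.exp (-β * Real.cosh r) / Real.cosh r)) =
      Real.sinh r ^ 4 * Real.exp (-β * Real.cosh r) := fun r => by
    have := (Real.cosh_pos r).ne'
    rw [show Real.cosh r ^ 2 - 1 = Real.sinh r ^ 2 by rw [Real.cosh_sq]; ring]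
    field_simp
  simp only [h3, integral_sinh_pow_four hβ, q0_sq, add_sub_cancel_left] at h1
  rw [h1, Mf_eq, h2]
  ring

end Radial

section Isotropy

lemma integral_comp_isometry (e : E3 ≃ₗᵢ[ℝ] E3) (f : E3 → ℝ) : ∫ q, f (e q) = ∫ q, f q :=
  e.measurePreserving.integral_comp e.toHomeomorph.measurableEmbedding f

lemma integral_coord_mul_coord_of_ne (g : ℝ → ℝ) {i j : Fin 3} (h : i ≠ j) :
    ∫ q : E3, q i * q j * g ‖q‖ = 0 := by
  have := integral_comp_isometry (LinearIsometryEquiv.piLpCongrRight 2 fun k : Fin 3 =>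
    if k = i then LinearIsometryEquiv.neg ℝ else LinearIsometryEquiv.refl ℝ ℝ)
    fun q => q i * q j * g ‖q‖
  simp only [LinearIsometryEquiv.norm_map] at this
  simp [h.symm, integral_neg] at this
  linarith

lemma integral_coord_sq (g : ℝ → ℝ) (i j : Fin 3) :
    ∫ q : E3, q i * q i * g ‖q‖ = ∫ q : E3, q j * q j * g ‖q‖ := by
  have := integral_comp_isometry (LinearIsometryEquiv.piLpCongrLeft 2 ℝ ℝ (Equiv.swap i j))
    fun q => q i * q i * g ‖q‖
  simp only [LinearIsometryEquiv.norm_map] at this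
  simpa [Equiv.piCongrLeft'] using this.symm

lemma abs_coord_le (q : E3) (i : Fin 3) : |q i| ≤ ‖q‖ := PiLp.norm_apply_le q i

lemma integral_inner_mul_inner (g : ℝ → ℝ) (a b : E3)
    (hi : ∀ i j : Fin 3, Integrable fun q : E3 => q i * q j * g ‖q‖) :
    ∫ q : E3, ⟪a, q⟫_ℝ * ⟪b, q⟫_ℝ * g ‖q‖ = ⟪a, b⟫_ℝ * (∫ q : E3, ‖q‖ ^ 2 * g ‖q‖) / 3 := by
  have hnorm : ∫ q : E3, ‖q‖ ^ 2 * g ‖q‖ = 3 * ∫ q : E3, q 0 * q 0 * g ‖q‖ := by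
    have : ∀ q : E3, ‖q‖ ^ 2 * g ‖q‖ = ∑ i : Fin 3, q i * q i * g ‖q‖ := fun q => by
      rw [EuclideanSpace.real_norm_sq_eq, Finset.sum_mul]
      simp only [pow_two]
    simp only [this]
    rw [integral_finsetSum _ fun i _ => hi i i, Finset.sum_congr rfl fun i _ =>
      integral_coord_sq g i 0]
    simp
  have hexp : ∀ q : E3, ⟪a, q⟫_ℝ * ⟪b, q⟫_ℝ * g ‖q‖ =
      ∑ i : Fin 3, ∑ j : Fin 3, a i * b j * (q i * q j * g ‖q‖) := fun q => by
    simp only [PiLp.inner_apply, RCLike.inner_apply, conj_trivial]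
    rw [Finset.sum_mul_sum]
    simp only [Finset.sum_mul]
    refine Finset.sum_congr rfl fun i _ => Finset.sum_congr rfl fun j _ => by ring
  simp only [hexp]
  rw [integral_finsetSum _ fun i _ => integrable_finsetSum _ fun j _ => (hi i j).const_mul _]
  have hrow : ∀ i : Fin 3, ∫ q : E3, ∑ j : Fin 3, a i * b j * (q i * q j * g ‖q‖) =
      a i * b i * ∫ q : E3, q 0 * q 0 * g ‖q‖ := fun i => by
    rw [integral_finsetSum _ fun j _ => (hi i j).const_mul _]
    simp only [integral_const_mul]
    rw [Finset.sum_eq_single i, integral_coord_sq g i 0]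
    · intro j _ hj
      rw [integral_coord_mul_coord_of_ne g hj.symm, mul_zero]
    · simp
  simp only [hrow, hnorm, ← Finset.sum_mul, PiLp.inner_apply, RCLike.inner_apply, conj_trivial,
    mul_comm (b _)]
  ring

end Isotropy

section RestFrame

/-- The weight `exp(-β q⁰) / q⁰` of the rest-frame moments. -/
noncomputable def weight (β : ℝ) (q : E3) : ℝ := Real.exp (-β * q0 q) / q0 q

lemma continuous_weight (β : ℝ) : Continuous (weight β) := by
  have := continuous_q0
  exact Continuous.div (by fun_prop) this fun q => (q0_pos q).ne'

lemma weight_neg (β : ℝ) (q : E3) : weight β (-q) = weight β q := by simp [weight, q0_neg]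

lemma integrable_mul_weight {β : ℝ} (hβ : 0 < β) {f : E3 → ℝ} (hf : Continuous f) {C : ℝ} (k : ℕ)
    (hb : ∀ q, |f q| ≤ C * q0 q ^ k) : Integrable fun q => f q * weight β q := by
  refine integrable_of_abs_le hβ (hf.mul (continuous_weight β)) (C := C) k fun q => ?_
  have hq := q0_pos q
  have hw : |weight β q| ≤ Real.exp (-β * q0 q) := by
    rw [weight, abs_of_pos (by positivity)]
    exact div_le_self (Real.exp_pos _).le (one_le_q0 q)
  rw [abs_mul]
  exact mul_le_mul (hb q) hw (abs_nonneg _) ((abs_nonneg _).trans (hb q))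

lemma integral_odd_eq_zero {f : E3 → ℝ} (hf : ∀ q, f (-q) = -f q) : ∫ q, f q = 0 := by
  have h := integral_neg_eq_self f volume
  simp only [hf, integral_neg] at h
  linarith

lemma abs_inner_le_mul_q0 (a q : E3) : |⟪a, q⟫_ℝ| ≤ ‖a‖ * q0 q :=
  (abs_real_inner_le_norm a q).trans (mul_le_mul_of_nonneg_left (norm_le_q0 q) (norm_nonneg a))

/-- Rest-frame moments of a quadratic polynomial in the four-momentum. -/
lemma integral_quadratic_mul_weight {β : ℝ} (hβ : 0 < β) (c₀ c₁ c₂ : ℝ) (a b c d : E3) :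
    ∫ q : E3, (c₀ + c₁ * q0 q + c₂ * q0 q ^ 2 + ⟪a, q⟫_ℝ + q0 q * ⟪b, q⟫_ℝ
      + ⟪c, q⟫_ℝ * ⟪d, q⟫_ℝ) * weight β q =
    Mf β * ((c₀ + c₂) * (Kb 1 β / Kb 2 β) + c₁ + c₂ * (3 / β) + ⟪c, d⟫_ℝ / β) := by
  have hq0 := continuous_q0
  have i0 : Integrable fun q : E3 => 1 * weight β q :=
    integrable_mul_weight hβ (by fun_prop) (C := 1) 0 fun q => by simp
  have i1 : Integrable fun q : E3 => q0 q * weight β q :=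
    integrable_mul_weight hβ (by fun_prop) (C := 1) 1 fun q => by
      simp [abs_of_pos (q0_pos q)]
  have i2 : Integrable fun q : E3 => ‖q‖ ^ 2 * weight β q :=
    integrable_mul_weight hβ (by fun_prop) (C := 1) 2 fun q => by
      simp only [abs_pow, abs_norm, one_mul]
      exact pow_le_pow_left₀ (norm_nonneg q) (norm_le_q0 q) 2
  have ia : Integrable fun q : E3 => ⟪a, q⟫_ℝ * weight β q :=
    integrable_mul_weight hβ (by fun_prop) (C := ‖a‖) 1 fun q => by
      simpa using abs_inner_le_mul_q0 a q
  have ib : Integrable fun q : E3 => q0 q * ⟪b, q⟫_ℝ * weight β q :=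
    integrable_mul_weight hβ (by fun_prop) (C := ‖b‖) 2 fun q => by
      rw [abs_mul, abs_of_pos (q0_pos q)]
      nlinarith [mul_le_mul_of_nonneg_left (abs_inner_le_mul_q0 b q) (q0_pos q).le]
  have icd : Integrable fun q : E3 => ⟪c, q⟫_ℝ * ⟪d, q⟫_ℝ * weight β q :=
    integrable_mul_weight hβ (by fun_prop) (C := ‖c‖ * ‖d‖) 2 fun q => by
      rw [abs_mul]
      refine (mul_le_mul (abs_inner_le_mul_q0 c q) (abs_inner_le_mul_q0 d q) (abs_nonneg _)
        (by have := q0_pos q; positivity)).trans_eq (by ring)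
  have iij : ∀ i j : Fin 3, Integrable fun q : E3 => q i * q j * weight β q := fun i j =>
    integrable_mul_weight hβ (by fun_prop) (C := 1) 2 fun q => by
      rw [abs_mul, one_mul, pow_two]
      exact mul_le_mul ((abs_coord_le q i).trans (norm_le_q0 q))
        ((abs_coord_le q j).trans (norm_le_q0 q)) (abs_nonneg _) (q0_pos q).le
  have v0 : ∫ q : E3, 1 * weight β q = Mf β * (Kb 1 β / Kb 2 β) := by
    simp only [one_mul]
    exact integral_exp_div_q0 hβ
  have v1 : ∫ q : E3, q0 q * weight β q = Mf β := by
    rw [Mf_eq]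
    refine integral_congr_ae (ae_of_all _ fun q => ?_)
    exact mul_div_cancel₀ _ (q0_pos q).ne'
  have v2 : ∫ q : E3, ‖q‖ ^ 2 * weight β q = 3 * (Mf β / β) := integral_norm_sq_mul_exp_div_q0 hβ
  have va : ∫ q : E3, ⟪a, q⟫_ℝ * weight β q = 0 :=
    integral_odd_eq_zero fun q => by simp [weight_neg]
  have vb : ∫ q : E3, q0 q * ⟪b, q⟫_ℝ * weight β q = 0 :=
    integral_odd_eq_zero fun q => by simp [weight_neg, q0_neg]
  have vcd : ∫ q : E3, ⟪c, q⟫_ℝ * ⟪d, q⟫_ℝ * weight β q = ⟪c, d⟫_ℝ * (3 * (Mf β / β)) / 3 := by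
    rw [← v2]
    exact integral_inner_mul_inner
      (fun x => Real.exp (-β * Real.sqrt (1 + x ^ 2)) / Real.sqrt (1 + x ^ 2)) c d iij
  have hexp : ∀ q : E3, (c₀ + c₁ * q0 q + c₂ * q0 q ^ 2 + ⟪a, q⟫_ℝ + q0 q * ⟪b, q⟫_ℝ
      + ⟪c, q⟫_ℝ * ⟪d, q⟫_ℝ) * weight β q =
      (c₀ + c₂) * (1 * weight β q) + c₁ * (q0 q * weight β q) + c₂ * (‖q‖ ^ 2 * weight β q)
      + ⟪a, q⟫_ℝ * weight β q + q0 q * ⟪b, q⟫_ℝ * weight β q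
      + ⟪c, q⟫_ℝ * ⟪d, q⟫_ℝ * weight β q := fun q => by
    rw [q0_sq]
    ring
  have j1 := (i0.const_mul (c₀ + c₂)).add (i1.const_mul c₁)
  have j2 := j1.add (i2.const_mul c₂)
  have j3 := j2.add ia
  have j4 := j3.add ib
  rw [integral_congr_ae (ae_of_all _ hexp)]
  refine (integral_add j4 icd).trans ?_
  rw [vcd]
  have e4 := integral_add j3 ib
  have e3 := integral_add j2 ia
  have e2 := integral_add j1 (i2.const_mul c₂)
  have e1 := integral_add (i0.const_mul (c₀ + c₂)) (i1.const_mul c₁)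
  simp only [integral_const_mul, v0, v1, v2, va, vb, Pi.add_apply] at e1 e2 e3 e4
  simp only [Pi.add_apply]
  rw [e4, e3, e2, e1]
  ring

lemma integral_mul_jut_of_quadratic {n β : ℝ} (hβ : 0 < β) (u : E3) {g : E3 → ℝ} (c₀ c₁ c₂ : ℝ)
    (a b c d : E3) (hg : ∀ q, g (boost u q) = c₀ + c₁ * q0 q + c₂ * q0 q ^ 2 + ⟪a, q⟫_ℝ
      + q0 q * ⟪b, q⟫_ℝ + ⟪c, q⟫_ℝ * ⟪d, q⟫_ℝ) :
    ∫ q, g q * Jut n β u q / q0 q =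
      n * ((c₀ + c₂) * (Kb 1 β / Kb 2 β) + c₁ + c₂ * (3 / β) + ⟪c, d⟫_ℝ / β) := by
  rw [integral_mul_jut]
  simp only [hg]
  have h := integral_quadratic_mul_weight hβ c₀ c₁ c₂ a b c d
  simp only [weight] at h
  rw [h]
  have := (Mf_pos hβ).ne'
  field_simp

lemma coord_boost (u q : E3) (i : Fin 3) :
    boost u q i = q i + (⟪u, q⟫_ℝ / (1 + q0 u) + q0 q) * u i := by
  simp [boost]

lemma inner_single_add_smul (u q : E3) (i : Fin 3) (t : ℝ) :
    ⟪EuclideanSpace.single i (1 : ℝ) + t • u, q⟫_ℝ = q i + t * ⟪u, q⟫_ℝ := by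
  rw [inner_add_left, real_inner_smul_left, EuclideanSpace.inner_single_left]
  simp

end RestFrame

/-- moments of a general Jüttner distribution `J(n,β,u;·)`. -/
theorem juttner_moments (n β : ℝ) (u : E3) (hn : 0 < n) (hβ : 0 < β) :
    (∫ q : E3, Jut n β u q) = n * Real.sqrt (1 + ‖u‖ ^ 2) ∧
    (∀ i : Fin 3, (∫ q : E3, q i * Jut n β u q / q0 q) = n * u i) ∧
    (∫ q : E3, ‖q‖ ^ 2 * Jut n β u q / q0 q)
      = n * Ψf β * ‖u‖ ^ 2 + (3 + ‖u‖ ^ 2) * (n / β) ∧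
    (∫ q : E3, Real.sqrt (1 + ‖q‖ ^ 2) * Jut n β u q)
      = (n / β) * ‖u‖ ^ 2 + n * Ψf β * (1 + ‖u‖ ^ 2) ∧
    (∀ i : Fin 3, (∫ q : E3, q i * Jut n β u q)
      = (n * Ψf β + n / β) * Real.sqrt (1 + ‖u‖ ^ 2) * u i) ∧
    (∫ q : E3, Jut n β u q / q0 q) = n * (Ψf β - 3 / β) ∧
    n * (Ψf β - 3 / β) = n * (Kb 1 β / Kb 2 β) := by
  have h1 : (1 + q0 u) ≠ 0 := by linarith [q0_pos u]
  have hu : ‖u‖ ^ 2 = q0 u ^ 2 - 1 := by rw [q0_sq]; ring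
  have hself : ⟪u, u⟫_ℝ = q0 u ^ 2 - 1 := by rw [real_inner_self_eq_norm_sq, hu]
  have hu0 : Real.sqrt (1 + ‖u‖ ^ 2) = q0 u := rfl
  have hΨ : Ψf β - 3 / β = Kb 1 β / Kb 2 β := by rw [Ψf]; ring
  refine ⟨?_, fun i => ?_, ?_, ?_, fun i => ?_, ?_, by rw [hΨ]⟩
  · have h := integral_mul_jut_of_quadratic (n := n) hβ u (g := q0) 0 (q0 u) 0 u 0 0 0 fun q => by
      rw [q0_boost]; simp
    rw [hu0]
    convert h using 2
    · ext q
      rw [mul_div_cancel_left₀ _ (q0_pos q).ne']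
    · simp
  · have h := integral_mul_jut_of_quadratic (n := n) hβ u (g := fun q => q i) 0 (u i) 0
      (EuclideanSpace.single i 1 + (u i / (1 + q0 u)) • u) 0 0 0 fun q => by
        rw [coord_boost, inner_single_add_smul, inner_zero_left]
        ring
    simpa using h
  · have h := integral_mul_jut_of_quadratic (n := n) hβ u (g := fun q => ‖q‖ ^ 2) (-1) 0
      (q0 u ^ 2) 0 ((2 * q0 u) • u) u u fun q => by
        rw [show ‖boost u q‖ ^ 2 = q0 (boost u q) ^ 2 - 1 by rw [q0_sq]; ring, q0_boost,
          inner_zero_left, real_inner_smul_left]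
        ring
    rw [h, hself, hu, Ψf]
    ring
  · have h := integral_mul_jut_of_quadratic (n := n) hβ u (g := fun q => q0 q * q0 q) 0 0
      (q0 u ^ 2) 0 ((2 * q0 u) • u) u u fun q => by
        rw [q0_boost, inner_zero_left, real_inner_smul_left]
        ring
    refine Eq.trans ?_ (h.trans ?_)
    · congr 1 with q
      rw [mul_assoc, mul_div_cancel_left₀ _ (q0_pos q).ne']
      rfl
    · rw [hself, hu, Ψf]
      ring
  · have h := integral_mul_jut_of_quadratic (n := n) hβ u (g := fun q => q i * q0 q) 0 0
      (q0 u * u i) 0 (q0 u • (EuclideanSpace.single i 1 + (u i / (1 + q0 u)) • u) + u i • u)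
      (EuclideanSpace.single i 1 + (u i / (1 + q0 u)) • u) u fun q => by
        rw [q0_boost, coord_boost, inner_zero_left, inner_add_left, real_inner_smul_left,
          real_inner_smul_left, inner_single_add_smul]
        ring
    refine Eq.trans ?_ (h.trans ?_)
    · congr 1 with q
      have := (q0_pos q).ne'
      field_simp
    · rw [inner_single_add_smul, hself, hu0, Ψf]
      field_simp
      ring
  · have h := integral_mul_jut_of_quadratic (n := n) hβ u (g := fun _ => 1) 1 0 0 0 0 0 0
      fun q => by simp
    rw [hΨ]
    simpa using h
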